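/- arXiv:2204.02204 — 2 statements merged into one kernel-verified Lean document; each statement's English description precedes it below -/
import Mathlib

section
/- Let s ≥ 5 be a natural number. Every automorphism of the line graph of the complete graph K_s on Fin s is induced by a unique permutation of Fin s; that is, the natural group homomorphism from Perm(Fin s) to the automorphism group of L(K_s), sending σ to the automorphism taking the edge {a,b} to the edge {σ(a),σ(b)}, is bijective. -/
open SimpleGraph

/-- The equivalence on `Sym2 α` induced by a permutation of `α`. -/
def sym2Congr {α : Type*} (σ : Equiv.Perm α) : Sym2 α ≃ Sym2 α where
  toFun := Sym2.map σ
  invFun := Sym2.map σ.symm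
  left_inv e := by
    rw [Sym2.map_map]
    simp [Function.comp_def]
  right_inv e := by
    rw [Sym2.map_map]
    simp [Function.comp_def]

/-- The natural automorphism of the line graph of the complete graph on `Fin s`
induced by a permutation `σ` of `Fin s`, sending the edge `{a, b}` to the edge
`{σ a, σ b}`. -/
def permToLineGraphAut {s : ℕ} (σ : Equiv.Perm (Fin s)) :
    (completeGraph (Fin s)).lineGraph ≃g (completeGraph (Fin s)).lineGraph where
  toEquiv := (sym2Congr σ).subtypeEquiv (fun e => by
    refine e.ind (fun a b => ?_)
    simp [sym2Congr, completeGraph, Sym2.map_pair_eq, σ.injective.ne_iff])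
  map_rel_iff' := by
    intro e f
    simp only [Equiv.subtypeEquiv_apply, lineGraph]
    constructor
    · rintro ⟨hne, v, hv⟩
      refine ⟨fun h => hne (by rw [h]), ?_⟩
      refine ⟨σ.symm v, ?_⟩
      constructor
      · have := hv.1
        simp only [sym2Congr, Equiv.coe_fn_mk, Set.mem_inter_iff] at this ⊢
        obtain ⟨a, ha, rfl⟩ := Sym2.mem_map.mp this
        simpa using ha
      · have := hv.2
        simp only [sym2Congr, Equiv.coe_fn_mk] at this ⊢
        obtain ⟨a, ha, rfl⟩ := Sym2.mem_map.mp this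
        simpa using ha
    · rintro ⟨hne, v, hv⟩
      refine ⟨?_, ⟨σ v, ?_, ?_⟩⟩
      · exact fun h =>
          hne (Subtype.ext ((sym2Congr σ).injective (Subtype.ext_iff.mp h)))
      · exact Sym2.mem_map.mpr ⟨v, hv.1, rfl⟩
      · exact Sym2.mem_map.mpr ⟨v, hv.2, rfl⟩

/-- If four unordered pairs pairwise meet, a point common to two distinct ones lies on a third,
provided the fourth differs from the other three. -/
theorem Sym2.mem_of_pairwise_meet {α : Type*} {e f g h : Sym2 α} {w : α}
    (hef : e ≠ f) (heh : e ≠ h) (hfh : f ≠ h) (hgh : g ≠ h)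
    (meg : ∃ v, v ∈ e ∧ v ∈ g) (mfg : ∃ v, v ∈ f ∧ v ∈ g) (meh : ∃ v, v ∈ e ∧ v ∈ h)
    (mfh : ∃ v, v ∈ f ∧ v ∈ h) (mgh : ∃ v, v ∈ g ∧ v ∈ h)
    (we : w ∈ e) (wf : w ∈ f) : w ∈ g := by
  obtain ⟨x, rfl⟩ := Sym2.mem_iff_exists.mp we
  obtain ⟨y, rfl⟩ := Sym2.mem_iff_exists.mp wf
  by_contra wg
  have hxy : x ≠ y := fun hxy => hef (by rw [hxy])
  have hxg : x ∈ g := by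
    obtain ⟨v, hv, hvg⟩ := meg
    rcases Sym2.mem_iff.mp hv with rfl | rfl
    exacts [absurd hvg wg, hvg]
  have hyg : y ∈ g := by
    obtain ⟨v, hv, hvg⟩ := mfg
    rcases Sym2.mem_iff.mp hv with rfl | rfl
    exacts [absurd hvg wg, hvg]
  obtain rfl : g = s(x, y) := (Sym2.mem_and_mem_iff hxy).mp ⟨hxg, hyg⟩
  induction h with | _ p q =>
  simp only [Sym2.mem_iff, Sym2.eq_iff, ne_eq] at *
  grind

/-- The edge of the complete graph joining two distinct vertices. -/
def completeGraphEdge {α : Type*} {a b : α} (h : a ≠ b) : (completeGraph α).edgeSet :=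
  ⟨s(a, b), h⟩

theorem lineGraph_adj_completeGraphEdge {α : Type*} {v a b : α} (ha : v ≠ a) (hb : v ≠ b)
    (hab : a ≠ b) :
    (completeGraph α).lineGraph.Adj (completeGraphEdge ha) (completeGraphEdge hb) := by
  refine lineGraph_adj_iff_exists.mpr ⟨fun h => ?_, v, by simp [completeGraphEdge]⟩
  exact hab (Sym2.congr_right.mp (congrArg Subtype.val h))

theorem Fin.exists_notMem_of_card_lt {s : ℕ} (t : Finset (Fin s)) (h : t.card < s) :
    ∃ x, x ∉ t := by
  by_contra! H
  simp [Finset.eq_univ_iff_forall.mpr H] at h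

/-- An automorphism of the line graph of a complete graph maps the star at a vertex into
the star at some vertex. -/
theorem exists_forall_mem_lineGraph_aut {s : ℕ} (hs : 5 ≤ s)
    (φ : (completeGraph (Fin s)).lineGraph ≃g (completeGraph (Fin s)).lineGraph) (v : Fin s) :
    ∃ w, ∀ c (h : v ≠ c), w ∈ (φ (completeGraphEdge h) : Sym2 (Fin s)) := by
  have adj {a b : Fin s} (ha : v ≠ a) (hb : v ≠ b) (hab : a ≠ b) :=
    lineGraph_adj_iff_exists.mp
      (φ.map_adj_iff.mpr (lineGraph_adj_completeGraphEdge ha hb hab))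
  obtain ⟨a, ha⟩ := Fin.exists_notMem_of_card_lt {v} (by simp; omega)
  obtain ⟨b, hb⟩ := Fin.exists_notMem_of_card_lt {v, a} (Finset.card_le_two.trans_lt (by omega))
  simp only [Finset.mem_insert, Finset.mem_singleton, not_or] at ha hb
  have hva : v ≠ a := Ne.symm ha
  have hvb : v ≠ b := Ne.symm hb.1
  have hab : a ≠ b := Ne.symm hb.2
  obtain ⟨nab, w, wa, wb⟩ := adj hva hvb hab
  refine ⟨w, fun c hvc => ?_⟩
  by_cases hac : a = c
  · subst hac; exact wa
  by_cases hbc : b = c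
  · subst hbc; exact wb
  obtain ⟨d, hd⟩ := Fin.exists_notMem_of_card_lt {v, a, b, c}
    (Finset.card_le_four.trans_lt (by omega))
  simp only [Finset.mem_insert, Finset.mem_singleton, not_or] at hd
  obtain ⟨hdv, hda, hdb, hdc⟩ := hd
  have hvd : v ≠ d := Ne.symm hdv
  have had := adj hva hvd (Ne.symm hda)
  have hbd := adj hvb hvd (Ne.symm hdb)
  have hcd := adj hvc hvd (Ne.symm hdc)
  exact Sym2.mem_of_pairwise_meet (Subtype.coe_ne_coe.mpr nab)
    (Subtype.coe_ne_coe.mpr had.1) (Subtype.coe_ne_coe.mpr hbd.1)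
    (Subtype.coe_ne_coe.mpr hcd.1) (adj hva hvc hac).2 (adj hvb hvc hbc).2
    had.2 hbd.2 hcd.2 wa wb

theorem permToLineGraphAut_completeGraphEdge {s : ℕ} (σ : Equiv.Perm (Fin s)) {a b : Fin s}
    (h : a ≠ b) : (permToLineGraphAut σ (completeGraphEdge h) : Sym2 (Fin s)) = s(σ a, σ b) :=
  rfl

theorem permToLineGraphAut_injective {s : ℕ} (hs : 3 ≤ s) :
    Function.Injective (permToLineGraphAut (s := s)) := by
  intro σ τ hστ
  have key {a b : Fin s} (h : a ≠ b) : s(σ a, σ b) = s(τ a, τ b) := by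
    rw [← permToLineGraphAut_completeGraphEdge σ h, hστ, permToLineGraphAut_completeGraphEdge]
  ext1 v
  obtain ⟨a, ha⟩ := Fin.exists_notMem_of_card_lt {v} (by simp; omega)
  obtain ⟨b, hb⟩ := Fin.exists_notMem_of_card_lt {v, a} (Finset.card_le_two.trans_lt (by omega))
  simp only [Finset.mem_insert, Finset.mem_singleton, not_or] at ha hb
  have h₁ := key (Ne.symm ha)
  have h₂ := key (Ne.symm hb.1)
  have hab := τ.injective.ne hb.2
  simp only [Sym2.eq_iff] at h₁ h₂
  grind

theorem permToLineGraphAut_surjective {s : ℕ} (hs : 5 ≤ s) :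
    Function.Surjective (permToLineGraphAut (s := s)) := by
  intro φ
  choose f hf using exists_forall_mem_lineGraph_aut hs φ
  have hinj : Function.Injective f := by
    intro a b hab
    by_contra hne
    obtain ⟨c, hc⟩ := Fin.exists_notMem_of_card_lt {a, b}
      (Finset.card_le_two.trans_lt (by omega))
    obtain ⟨d, hd⟩ := Fin.exists_notMem_of_card_lt {a, b, c}
      (Finset.card_le_three.trans_lt (by omega))
    simp only [Finset.mem_insert, Finset.mem_singleton, not_or] at hc hd
    have hac : a ≠ c := Ne.symm hc.1
    have hbd : b ≠ d := Ne.symm hd.2.1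
    have hedge : completeGraphEdge hac ≠ completeGraphEdge hbd := by
      intro h
      have := congrArg Subtype.val h
      simp only [completeGraphEdge, Sym2.eq_iff] at this
      grind
    have hadj : (completeGraph (Fin s)).lineGraph.Adj (φ (completeGraphEdge hac))
        (φ (completeGraphEdge hbd)) :=
      lineGraph_adj_iff_exists.mpr
        ⟨φ.injective.ne hedge, f a, hf a c hac, hab ▸ hf b d hbd⟩
    obtain ⟨-, v, hv₁, hv₂⟩ := lineGraph_adj_iff_exists.mp (φ.map_adj_iff.mp hadj)
    simp only [completeGraphEdge, Sym2.mem_iff] at hv₁ hv₂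
    grind
  refine ⟨Equiv.ofBijective f (Finite.injective_iff_bijective.mp hinj), ?_⟩
  ext1 ⟨e, he⟩
  induction e with | _ a b =>
  have hab : a ≠ b := he
  apply Subtype.ext
  refine ((Sym2.mem_and_mem_iff (hinj.ne hab)).mp ⟨hf a b hab, ?_⟩).symm
  have hba := hf b a hab.symm
  rwa [show completeGraphEdge hab.symm = completeGraphEdge hab from
    Subtype.ext Sym2.eq_swap] at hba

/-- For `s ≥ 5`, the natural group homomorphism from `Perm (Fin s)` to the automorphism
group of the line graph of the complete graph on `Fin s` (sending `σ` to the automorphism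
taking the edge `{a,b}` to `{σ a, σ b}`) is multiplicative and bijective: every
automorphism of `L(K_s)` is induced by a unique permutation of `Fin s`. -/
theorem lineGraph_completeGraph_aut_perm_bijective (s : ℕ) (hs : 5 ≤ s) :
    (∀ σ τ : Equiv.Perm (Fin s),
      permToLineGraphAut (σ * τ) = (permToLineGraphAut τ).trans (permToLineGraphAut σ)) ∧
    Function.Bijective (permToLineGraphAut (s := s)) := by
  refine ⟨fun σ τ => ?_, permToLineGraphAut_injective (by omega),
    permToLineGraphAut_surjective hs⟩
  ext1 ⟨e, he⟩
  induction e with | _ a b =>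
  rfl
end

section
/- Let s ≥ 5 be a natural number and let A and A' be subsets of Fin s such that A, Aᶜ, A', and A'ᶜ each have cardinality at least 2. If for every 2-element subset B of Fin s one has (B ⊆ A or B ⊆ Aᶜ) if and only if (B ⊆ A' or B ⊆ A'ᶜ), then A' = A or A' = Aᶜ. -/
theorem Finset.pair_subset_or_subset_compl_iff {α : Type*} [Fintype α] [DecidableEq α]
    (A : Finset α) (x y : α) :
    (({x, y} : Finset α) ⊆ A ∨ ({x, y} : Finset α) ⊆ Aᶜ) ↔ (x ∈ A ↔ y ∈ A) := by
  simp only [Finset.insert_subset_iff, Finset.singleton_subset_iff, Finset.mem_compl]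
  tauto

/-- Let `s ≥ 5` and let `A, A'` be subsets of `Fin s` such that `A`, `Aᶜ`, `A'`, `A'ᶜ`
each have cardinality at least 2. If a 2-element subset `B` of `Fin s` is contained in
`A` or in `Aᶜ` exactly when it is contained in `A'` or in `A'ᶜ`, then `A' = A` or
`A' = Aᶜ`.  (A sphere in the `s`-punctured 3-sphere, viewed as a two-piece partition of
the boundary spheres, is determined by the set of size-2 spheres disjoint from it.) -/
theorem partition_determined_by_size_two_spheres (s : ℕ) (hs : 5 ≤ s)
    (A A' : Finset (Fin s))
    (hA : 2 ≤ A.card) (hAc : 2 ≤ Aᶜ.card) (hA' : 2 ≤ A'.card) (hA'c : 2 ≤ A'ᶜ.card)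
    (h : ∀ B : Finset (Fin s), B.card = 2 →
      ((B ⊆ A ∨ B ⊆ Aᶜ) ↔ (B ⊆ A' ∨ B ⊆ A'ᶜ))) :
    A' = A ∨ A' = Aᶜ := by
  have key (x y : Fin s) : (x ∈ A ↔ y ∈ A) ↔ (x ∈ A' ↔ y ∈ A') := by
    rcases eq_or_ne x y with rfl | hxy
    · simp
    · simpa only [Finset.pair_subset_or_subset_compl_iff] using h {x, y} (Finset.card_pair hxy)
  let x₀ : Fin s := ⟨0, by omega⟩
  by_cases hx : x₀ ∈ A' ↔ x₀ ∈ A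
  · left
    ext y
    have := key x₀ y
    tauto
  · right
    ext y
    have := key x₀ y
    rw [Finset.mem_compl]
    tauto
end
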